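/- For the trace monoid M on the 5-cycle independence graph with uniform valuation f(u) = p₀^{|u|} where p₀ = 1/2 - √5/10, the function λ(u) = (p₁/p₀)^{|u|} with p₁ = 1/2 + √5/10 is Möbius harmonic: Σ_{c clique} (-1)^{|c|} f(c) λ(u·c) = 0 for all u ∈ M. -/

import Mathlib

open scoped Classical

/-- A clique of the independence graph `(Σ, I)`. -/
def IsCliq {α : Type*} (I : α → α → Prop) (c : Finset α) : Prop :=
  ∀ a ∈ c, ∀ b ∈ c, a ≠ b → I a b

/-- Cartier–Foata admissibility `c → c'`. -/
def CFadm {α : Type*} (I : α → α → Prop) (c c' : Finset α) : Prop :=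
  ∀ b ∈ c', ∃ a ∈ c, ¬ I a b

/-- Parallelism of cliques `c ∥ c'`, i.e. `c × c' ⊆ I`. -/
def Par {α : Type*} (I : α → α → Prop) (c c' : Finset α) : Prop :=
  ∀ a ∈ c, ∀ b ∈ c', I a b

/-- The commutation relation `ab = ba` for `(a,b) ∈ I`, generating the trace
monoid congruence on the free monoid. -/
def traceRel {α : Type*} (I : α → α → Prop) : FreeMonoid α → FreeMonoid α → Prop :=
  fun x y => ∃ a b, I a b ∧ x = FreeMonoid.of a * FreeMonoid.of b ∧
    y = FreeMonoid.of b * FreeMonoid.of a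

/-- The trace monoid `M(Σ, I) = Σ* / R`. -/
abbrev TM {α : Type*} (I : α → α → Prop) := Con.Quotient (conGen (traceRel I))

/-- Canonical projection from the free monoid onto the trace monoid. -/
def mkTM {α : Type*} (I : α → α → Prop) : FreeMonoid α →* TM I := Con.mk' _

/-- The image of a letter in the trace monoid. -/
def emb {α : Type*} (I : α → α → Prop) (a : α) : TM I := mkTM I (FreeMonoid.of a)

/-- The trace associated to a clique (product of its letters in some enumeration). -/
noncomputable def ctr {α : Type*} (I : α → α → Prop) (c : Finset α) : TM I :=
  mkTM I ((c.toList.map FreeMonoid.of).prod)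

/-- The prefix (left divisibility) order on traces: `u ≤ v ↔ ∃ w, v = u·w`. -/
def pref {α : Type*} (I : α → α → Prop) (u v : TM I) : Prop := ∃ w, v = u * w

/-- The 5-cycle independence graph on `Fin 5`. -/
def I5 : Fin 5 → Fin 5 → Prop := fun a b => a ≠ b ∧ (b = a + 1 ∨ a = b + 1)

/-- The smaller root `p₀ = 1/2 - √5/10` of the Möbius polynomial `1 - 5X + 5X²`. -/
noncomputable def p0 : ℝ := 1 / 2 - Real.sqrt 5 / 10

/-- The larger root `p₁ = 1/2 + √5/10` of the Möbius polynomial `1 - 5X + 5X²`. -/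
noncomputable def p1 : ℝ := 1 / 2 + Real.sqrt 5 / 10

/-- An additive length on traces that is `1` on letters sends a clique to its cardinality. -/
theorem len_ctr {α : Type*} (I : α → α → Prop) (len : TM I → ℕ)
    (hlen1 : ∀ a, len (emb I a) = 1) (hlenm : ∀ u v : TM I, len (u * v) = len u + len v)
    (c : Finset α) : len (ctr I c) = c.card := by
  have hone : len 1 = 0 := by
    have h := hlenm 1 1
    rw [one_mul] at h
    omega
  have hlist (l : List α) : len (mkTM I (l.map FreeMonoid.of).prod) = l.length := by
    induction l with
    | nil => simpa using hone
    | cons a l ih =>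
      rw [List.map_cons, List.prod_cons, map_mul, hlenm, ih, List.length_cons, add_comm]
      exact congrArg (l.length + ·) (hlen1 a)
  rw [ctr, hlist, Finset.length_toList]

section Decidability

local instance decidableRelI5 : DecidableRel I5 := fun a b =>
  inferInstanceAs (Decidable (a ≠ b ∧ (b = a + 1 ∨ a = b + 1)))

local instance decidableIsCliq {α : Type*} [DecidableEq α] (I : α → α → Prop) [DecidableRel I] :
    DecidablePred (IsCliq I) := fun c =>
  inferInstanceAs (Decidable (∀ a ∈ c, ∀ b ∈ c, a ≠ b → I a b))

/-- The 5-cycle has one empty clique, five vertices and five edges. -/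
theorem map_card_cliques_I5 :
    (Finset.univ.filter (IsCliq I5)).val.map Finset.card = {0, 1, 1, 1, 1, 1, 2, 2, 2, 2, 2} := by
  decide

theorem sum_cliques_I5 (g : ℕ → ℝ) :
    ∑ c ∈ Finset.univ.filter (IsCliq I5), g c.card = g 0 + 5 * g 1 + 5 * g 2 := by
  have h := congrArg (fun s => (s.map g).sum) map_card_cliques_I5
  simp only [Multiset.map_map] at h
  refine Eq.trans h ?_
  simp
  ring

end Decidability

theorem p0_pos : 0 < p0 := by
  have h : Real.sqrt 5 < 5 := by
    rw [Real.sqrt_lt' (by norm_num)]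
    norm_num
  unfold p0
  linarith

theorem moebius_p1 : 1 - 5 * p1 + 5 * p1 ^ 2 = 0 := by
  have h : Real.sqrt 5 ^ 2 = 5 := Real.sq_sqrt (by norm_num)
  unfold p1
  linear_combination h / 20

/-- On the trace monoid of the 5-cycle with uniform valuation `f(u) = p₀^{|u|}`,
the function `λ(u) = (p₁/p₀)^{|u|}` is Möbius harmonic. -/
theorem unbounded_harmonic_C5
    (len : TM I5 → ℕ) (hlen1 : ∀ a : Fin 5, len (emb I5 a) = 1)
    (hlenm : ∀ u v : TM I5, len (u * v) = len u + len v) :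
    ∀ u : TM I5,
      (∑ c : Finset (Fin 5),
        if IsCliq I5 c then
          (-1 : ℝ) ^ c.card * p0 ^ (len (ctr I5 c)) * (p1 / p0) ^ (len (u * ctr I5 c))
        else 0) = 0 := by
  intro u
  have hterm (c : Finset (Fin 5)) :
      (-1 : ℝ) ^ c.card * p0 ^ (len (ctr I5 c)) * (p1 / p0) ^ (len (u * ctr I5 c)) =
        (p1 / p0) ^ len u * (-p1) ^ c.card := by
    rw [hlenm, len_ctr I5 len hlen1 hlenm, pow_add, neg_pow p1, div_pow p1 p0 c.card]
    field_simp [p0_pos.ne']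
  have hsum := sum_cliques_I5 (fun n => (-p1) ^ n)
  simp only [hterm]
  rw [← Finset.sum_filter, ← Finset.mul_sum]
  convert mul_zero ((p1 / p0) ^ len u)
  trans (-p1) ^ 0 + 5 * (-p1) ^ 1 + 5 * (-p1) ^ 2
  · convert hsum
  · linear_combination moebius_p1
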